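/- If f_c has a Siegel disk Δ of some period m ≥ 1, then the orbit of 0 under f_c is bounded; that is, c belongs to the Mandelbrot set M (equivalently, the Julia set J_c is connected). -/

import Mathlib

open Filter Metric Topology

noncomputable section

/-- The quadratic polynomial `f_c(z) = z² + c`. -/
def f (c : ℂ) : ℂ → ℂ := fun z => z ^ 2 + c

/-- `Δ` is a Siegel disk of `f_c` of period `m ≥ 1` with center `ζ`. -/
def IsSiegelDisk (c : ℂ) (m : ℕ) (Δ : Set ℂ) (ζ : ℂ) : Prop :=
  1 ≤ m ∧ IsOpen Δ ∧ IsConnected Δ ∧ ζ ∈ Δ ∧ (f c)^[m] '' Δ = Δ ∧ (f c)^[m] ζ = ζ ∧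
    ∃ α : ℝ, Irrational α ∧ ∃ φ : ℂ → ℂ,
      DifferentiableOn ℂ φ Δ ∧ Set.BijOn φ Δ (Metric.ball (0 : ℂ) 1) ∧ φ ζ = 0 ∧
      ∀ w ∈ Δ, φ ((f c)^[m] w) = Complex.exp (2 * Real.pi * Complex.I * α) * φ w

/-- A zero-free holomorphic function on a disk has a holomorphic square root with a prescribed
value at the centre. -/
theorem exists_differentiableOn_sq_eq {h : ℂ → ℂ} {a s₀ : ℂ} {r : ℝ} (hr : 0 < r)
    (hd : DifferentiableOn ℂ h (ball a r)) (h0 : ∀ z ∈ ball a r, h z ≠ 0) (hs₀ : s₀ ^ 2 = h a) :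
    ∃ s : ℂ → ℂ, DifferentiableOn ℂ s (ball a r) ∧ (∀ z ∈ ball a r, s z ^ 2 = h z) ∧
      s a = s₀ := by
  have ha : a ∈ ball a r := mem_ball_self hr
  have hdl : DifferentiableOn ℂ (fun z => deriv h z / h z) (ball a r) :=
    (hd.deriv isOpen_ball).div hd h0
  obtain ⟨G, hGa, hG⟩ := hdl.isExactOn_ball.with_val_at a 0
  have hGd : DifferentiableOn ℂ G (ball a r) := fun z hz =>
    (hG z hz).differentiableAt.differentiableWithinAt
  have key : ∀ z ∈ ball a r, h z * Complex.exp (-G z) = h a := by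
    intro z hz
    have hc : ∀ w ∈ ball a r, HasDerivAt (fun w => h w * Complex.exp (-G w)) 0 w := by
      intro w hw
      have h1 := (hd.differentiableAt (isOpen_ball.mem_nhds hw)).hasDerivAt
      refine (h1.mul (hG w hw).neg.cexp).congr_deriv ?_
      linear_combination (-Complex.exp (-G w)) * mul_div_cancel₀ (deriv h w) (h0 w hw)
    have := (convex_ball a r).is_const_of_fderivWithin_eq_zero (𝕜 := ℂ)
      (f := fun w => h w * Complex.exp (-G w))
      (fun w hw => (hc w hw).differentiableAt.differentiableWithinAt)
      (fun w hw => by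
        rw [fderivWithin_of_isOpen isOpen_ball hw]
        ext
        simpa using (hc w hw).deriv) hz ha
    simpa [hGa] using this
  refine ⟨fun z => s₀ * Complex.exp (G z / 2), ?_, ?_, by simp [hGa]⟩
  · exact (hGd.div_const 2).cexp.const_mul s₀
  · intro z hz
    rw [mul_pow, hs₀, ← key z hz, ← Complex.exp_nat_mul, mul_assoc, ← Complex.exp_add]
    push_cast
    rw [show -G z + 2 * (G z / 2) = 0 by ring]
    simp

theorem hasDerivAt_f (c z : ℂ) : HasDerivAt (f c) (2 * z) z := by
  have h := (hasDerivAt_pow 2 z).add_const c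
  rw [Nat.cast_ofNat, pow_one] at h
  exact h

theorem differentiable_f_iterate (c : ℂ) (n : ℕ) : Differentiable ℂ (f c)^[n] :=
  Differentiable.iterate (fun z => (hasDerivAt_f c z).differentiableAt) n

theorem deriv_f_iterate_succ (c : ℂ) (n : ℕ) (z : ℂ) :
    deriv (f c)^[n + 1] z = deriv (f c)^[n] (f c z) * (2 * z) := by
  rw [Function.iterate_succ]
  exact (((differentiable_f_iterate c n) _).hasDerivAt.comp z (hasDerivAt_f c z)).deriv

/-- If the preimage of the bounded open set `U` lies in a compact subset of `U` and `U` does not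
contain the critical value, then `f c` is uniformly expanding along backward orbits in `U`. -/
theorem exists_pow_le_norm_deriv_iterate {c : ℂ} {U L : Set ℂ} {R : ℝ} (hU : IsOpen U)
    (hL : IsCompact L) (hLU : L ⊆ U) (hUR : U ⊆ ball 0 R) (hfU : ∀ z, f c z ∈ U → z ∈ L)
    (hc : c ∉ U) {x : ℕ → ℂ} (hxU : ∀ k, x k ∈ U) (hx : ∀ k, f c (x (k + 1)) = x k) :
    ∃ C : ℝ, ∃ q : ℝ, 1 < q ∧ ∀ k, q ^ k ≤ C * ‖deriv (f c)^[k] (x k)‖ := by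
  obtain ⟨δ, hδ, hthick⟩ := hL.exists_thickening_subset_open hU hLU
  obtain ⟨r, hr, hball⟩ := Metric.isOpen_iff.mp hU _ (hxU 0)
  have hR : 0 < R := pos_of_mem_ball (hUR (hxU 0))
  set ε : ℝ := δ / (2 * R) with hε
  have hε0 : 0 < ε := by positivity
  have key : ∀ k, ∃ h : ℂ → ℂ, DifferentiableOn ℂ h (ball (x 0) r) ∧
      Set.MapsTo h (ball (x 0) r) U ∧ h (x 0) = x k ∧
      deriv h (x 0) * deriv (f c)^[k] (x k) = (1 + ε) ^ k := by
    intro k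
    induction k with
    | zero => exact ⟨id, differentiableOn_id, hball, rfl, by simp⟩
    | succ k ih =>
      obtain ⟨h, hd, hm, hv, hder⟩ := ih
      obtain ⟨s, hsd, hs, hsv⟩ := exists_differentiableOn_sq_eq (s₀ := x (k + 1)) hr
        (hd.sub_const c) (fun z hz => sub_ne_zero.mpr fun h => hc (h ▸ hm hz))
        (by rw [hv, ← hx k]; simp [f])
      have hfs : ∀ z ∈ ball (x 0) r, f c (s z) = h z := fun z hz => by simp [f, hs z hz]
      have hmem : x 0 ∈ ball (x 0) r := mem_ball_self hr
      have hs' := (hsd.differentiableAt (isOpen_ball.mem_nhds hmem)).hasDerivAt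
      have hsq : deriv h (x 0) = 2 * x (k + 1) * deriv s (x 0) := by
        have h1 := (hasDerivAt_f c (s (x 0))).comp (x 0) hs'
        rw [hsv] at h1
        rw [← h1.deriv]
        refine Filter.EventuallyEq.deriv_eq ?_
        filter_upwards [isOpen_ball.mem_nhds hmem] with z hz using (hfs z hz).symm
      refine ⟨fun z => s z + ε * (s z - x (k + 1)), ?_, ?_, by simp [hsv], ?_⟩
      · exact hsd.add ((hsd.sub_const _).const_mul _)
      · intro z hz
        have hsL : s z ∈ L := hfU _ (by rw [hfs z hz]; exact hm hz)
        refine hthick (mem_thickening_iff.mpr ⟨s z, hsL, ?_⟩)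
        have h1 := mem_ball_zero_iff.mp (hUR (hLU hsL))
        have h2 := mem_ball_zero_iff.mp (hUR (hxU (k + 1)))
        have h3 := norm_sub_le (s z) (x (k + 1))
        rw [dist_eq_norm, add_sub_cancel_left, norm_mul, Complex.norm_real, Real.norm_eq_abs,
          abs_of_pos hε0]
        calc ε * ‖s z - x (k + 1)‖ < ε * (2 * R) := by gcongr; linarith
          _ = δ := by rw [hε]; field_simp
      · have h1 := hs'.add ((hs'.sub_const (x (k + 1))).const_mul (ε : ℂ))
        have h2 : deriv (fun z => s z + ε * (s z - x (k + 1))) (x 0) =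
          deriv s (x 0) + ε * deriv s (x 0) := h1.deriv
        rw [h2, deriv_f_iterate_succ, hx, pow_succ, ← hder, hsq]
        ring
  refine ⟨2 * R / r, 1 + ε, by linarith, fun k => ?_⟩
  obtain ⟨h, hd, hm, hv, hder⟩ := key k
  have hbound : ‖deriv h (x 0)‖ ≤ 2 * R / r := by
    refine Complex.norm_deriv_le_div_of_mapsTo_ball hd (fun z hz => ?_) hr
    have h1 := mem_ball_zero_iff.mp (hUR (hm hz))
    have h2 := mem_ball_zero_iff.mp (hUR (hxU k))
    rw [mem_closedBall, dist_eq_norm, hv]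
    linarith [norm_sub_le (h z) (x k)]
  have h1 := congrArg norm hder
  rw [norm_mul, norm_pow, ← Complex.ofReal_one, ← Complex.ofReal_add, Complex.norm_real,
    Real.norm_eq_abs, abs_of_pos (by linarith)] at h1
  rw [← h1]
  gcongr

/-- The multiplier at a fixed point of a map which an injective holomorphic function conjugates
to multiplication by a number of modulus one has modulus one. -/
theorem norm_deriv_eq_one_of_semiconj {F φ : ℂ → ℂ} {Δ : Set ℂ} {ζ μ : ℂ} (hΔ : IsOpen Δ)
    (hζ : ζ ∈ Δ) (hF : DifferentiableAt ℂ F ζ) (hFζ : F ζ = ζ) (hφ : DifferentiableOn ℂ φ Δ)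
    (hinj : Set.InjOn φ Δ) (hφζ : φ ζ = 0) (hconj : ∀ w ∈ Δ, φ (F w) = μ * φ w)
    (hμ : ‖μ‖ = 1) : ‖deriv F ζ‖ = 1 := by
  have han : AnalyticAt ℂ φ ζ := hφ.analyticAt (hΔ.mem_nhds hζ)
  have hne : ¬ ∀ᶠ z in 𝓝 ζ, φ z = 0 := by
    intro h
    have h' : ∀ᶠ z in 𝓝[≠] ζ, z = ζ := by
      filter_upwards [nhdsWithin_le_nhds h, nhdsWithin_le_nhds (hΔ.mem_nhds hζ)] with z hz hzΔ
      exact hinj hzΔ hζ (hz.trans hφζ.symm)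
    obtain ⟨z, hz, hz'⟩ := (h'.and self_mem_nhdsWithin).exists
    exact hz' hz
  obtain ⟨n, g, hg, hg0, hφg⟩ := han.exists_eventuallyEq_pow_smul_nonzero_iff.mpr hne
  have hn : n ≠ 0 := by
    rintro rfl
    have := hφg.self_of_nhds
    simp [hφζ] at this
    exact hg0 this.symm
  have hFt : Tendsto F (𝓝 ζ) (𝓝 ζ) := by simpa [hFζ] using hF.continuousAt.tendsto
  have hQ : Tendsto (dslope F ζ) (𝓝[≠] ζ) (𝓝 (deriv F ζ)) := by
    have := (continuousAt_dslope_same.mpr hF).tendsto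
    rw [dslope_same] at this
    exact this.mono_left nhdsWithin_le_nhds
  have hlim1 : Tendsto (fun z => dslope F ζ z ^ n * g (F z)) (𝓝[≠] ζ)
      (𝓝 (deriv F ζ ^ n * g ζ)) :=
    (hQ.pow n).mul ((hg.continuousAt.tendsto.comp hFt).mono_left nhdsWithin_le_nhds)
  have hlim2 : Tendsto (fun z => μ * g z) (𝓝[≠] ζ) (𝓝 (μ * g ζ)) :=
    (hg.continuousAt.tendsto.mono_left nhdsWithin_le_nhds).const_mul μ
  have heq : (fun z => dslope F ζ z ^ n * g (F z)) =ᶠ[𝓝[≠] ζ] fun z => μ * g z := by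
    filter_upwards [nhdsWithin_le_nhds hφg, nhdsWithin_le_nhds (hFt.eventually hφg),
      nhdsWithin_le_nhds (hΔ.mem_nhds hζ), self_mem_nhdsWithin] with z h1 h2 h3 h4
    have h5 : (z - ζ) * dslope F ζ z = F z - ζ := by
      simpa [hFζ] using sub_smul_dslope F ζ z
    have h6 := hconj z h3
    rw [h1, h2, ← h5, smul_eq_mul, smul_eq_mul, mul_pow] at h6
    refine mul_left_cancel₀ (pow_ne_zero n (sub_ne_zero.mpr h4)) ?_
    linear_combination h6
  have := tendsto_nhds_unique (hlim1.congr' heq) hlim2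
  have h7 := mul_right_cancel₀ hg0 this
  rw [← pow_eq_one_iff_of_nonneg (norm_nonneg _) hn, ← norm_pow, h7, hμ]

/-- Outside the disk of radius `2 + ‖c‖` the map `f c` increases the modulus. -/
theorem norm_lt_norm_f {c z : ℂ} (hz : 2 + ‖c‖ ≤ ‖z‖) : ‖z‖ < ‖f c z‖ := by
  have h1 : ‖z‖ ^ 2 - ‖c‖ ≤ ‖f c z‖ := by
    rw [← norm_pow]
    exact norm_sub_le_norm_add (z ^ 2) c
  nlinarith [norm_nonneg c]

theorem norm_lt_norm_f_iterate_succ {c z : ℂ} (hz : 2 + ‖c‖ ≤ ‖z‖) (n : ℕ) :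
    ‖z‖ < ‖(f c)^[n + 1] z‖ := by
  induction n with
  | zero => exact norm_lt_norm_f hz
  | succ n ih =>
    rw [Function.iterate_succ_apply']
    exact ih.trans (norm_lt_norm_f (hz.trans ih.le))

/-- Every cycle of `f c` is repelling when the orbit of `0` escapes. -/
theorem one_lt_norm_deriv_of_unbounded {c ζ : ℂ} {m : ℕ} (hm : 1 ≤ m)
    (hζ : (f c)^[m] ζ = ζ) (hc : ¬ Bornology.IsBounded (Set.range fun n => (f c)^[n] 0)) :
    1 < ‖deriv (f c)^[m] ζ‖ := by
  set R := 2 + ‖c‖ with hR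
  obtain ⟨N, hN⟩ : ∃ N, R ≤ ‖(f c)^[N] c‖ := by
    by_contra! h
    refine hc (isBounded_iff_forall_norm_le.mpr ⟨R, ?_⟩)
    rintro _ ⟨n, rfl⟩
    cases n with
    | zero => simp only [Function.iterate_zero, id, norm_zero]; positivity
    | succ n => simpa [f] using (h n).le
  have hcont : ∀ n, Continuous (f c)^[n] := fun n => (differentiable_f_iterate c n).continuous
  have hback : ∀ n z, ‖(f c)^[n] z‖ < R → ‖z‖ < R := by
    intro n z h
    by_contra! hz
    cases n with
    | zero => exact absurd h (not_lt.mpr hz)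
    | succ n => linarith [norm_lt_norm_f_iterate_succ hz n]
  have hstep : ∀ z, ‖f c z‖ ≤ R → ‖z‖ < R := by
    intro z h
    by_contra! hz
    linarith [norm_lt_norm_f hz]
  have hper : ∀ k, (f c)^[m] ((f c)^[k] ζ) = (f c)^[k] ζ := fun k => by
    rw [← Function.iterate_add_apply, add_comm, Function.iterate_add_apply, hζ]
  have hsmall : ∀ k, ‖(f c)^[k] ζ‖ < R := by
    intro k
    by_contra! hz
    have := norm_lt_norm_f_iterate_succ hz (m - 1)
    rw [Nat.sub_add_cancel hm, hper k] at this
    exact lt_irrefl _ this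
  have hLclosed : IsClosed {z | ‖(f c)^[N + 1] z‖ ≤ R} :=
    isClosed_le (hcont _).norm continuous_const
  have hLU : {z | ‖(f c)^[N + 1] z‖ ≤ R} ⊆ {z | ‖(f c)^[N] z‖ < R} := fun z hz => by
    rw [Set.mem_ofPred_eq, Function.iterate_succ_apply'] at hz
    exact hstep _ hz
  have hUR : {z | ‖(f c)^[N] z‖ < R} ⊆ ball 0 R := fun z hz =>
    mem_ball_zero_iff.mpr (hback N z hz)
  have hLc : IsCompact {z | ‖(f c)^[N + 1] z‖ ≤ R} :=
    Metric.isCompact_of_isClosed_isBounded hLclosed (isBounded_ball.subset (hLU.trans hUR))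
  obtain ⟨C, q, hq, hCq⟩ := exists_pow_le_norm_deriv_iterate (c := c)
    (x := fun k => (f c)^[(m - 1) * k] ζ)
    (isOpen_lt (hcont N).norm continuous_const) hLc hLU hUR
    (fun z (hz : ‖(f c)^[N] (f c z)‖ < R) => by
      rw [← Function.iterate_succ_apply] at hz
      exact hz.le)
    (not_lt.mpr hN)
    (fun k => by
      rw [Set.mem_ofPred_eq, ← Function.iterate_add_apply]
      exact hsmall _)
    (fun k => by
      rw [← Function.iterate_succ_apply' (f c), ← hper ((m - 1) * k),
        ← Function.iterate_add_apply]
      congr 2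
      rw [Nat.mul_succ]
      omega)
  have hmult : ∀ n, deriv (f c)^[m * n] ζ = deriv (f c)^[m] ζ ^ n := by
    intro n
    rw [Function.iterate_mul]
    have hd := (differentiable_f_iterate c m ζ).hasDerivAt
    exact (hd.iterate ζ hζ n).deriv
  by_contra! hle
  obtain ⟨n, hn⟩ := pow_unbounded_of_one_lt (max C 0) hq
  have h1 := hCq (m * n)
  have h2 : (f c)^[(m - 1) * (m * n)] ζ = ζ := by
    rw [show (m - 1) * (m * n) = m * ((m - 1) * n) by ring, Function.iterate_mul]
    exact Function.iterate_fixed hζ _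
  simp only [h2] at h1
  rw [hmult, norm_pow] at h1
  have h3 : ‖deriv (f c)^[m] ζ‖ ^ n ≤ 1 := pow_le_one₀ (norm_nonneg _) hle
  have h4 : q ^ n ≤ q ^ (m * n) := pow_le_pow_right₀ hq.le (Nat.le_mul_of_pos_left n hm)
  have h5 : C * ‖deriv (f c)^[m] ζ‖ ^ n ≤ max C 0 * 1 := by
    gcongr
    exact le_max_left C 0
  linarith

/-- If `f_c` has a Siegel disk then the orbit of `0` under `f_c` is bounded, i.e. `c`
belongs to the Mandelbrot set. -/
theorem mem_mandelbrot_of_siegelDisk (c : ℂ) (m : ℕ) (Δ : Set ℂ) (ζ : ℂ)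
    (hΔ : IsSiegelDisk c m Δ ζ) :
    Bornology.IsBounded (Set.range fun n => (f c)^[n] 0) := by
  obtain ⟨hm, hopen, -, hζ, -, hfix, α, -, φ, hφ, hbij, hφζ, hconj⟩ := hΔ
  by_contra hc
  refine (one_lt_norm_deriv_of_unbounded hm hfix hc).ne' ?_
  refine norm_deriv_eq_one_of_semiconj hopen hζ (differentiable_f_iterate c m ζ) hfix hφ
    hbij.injOn hφζ hconj ?_
  rw [show (2 * Real.pi * Complex.I * α : ℂ) = ((2 * Real.pi * α : ℝ) : ℂ) * Complex.I by
    push_cast; ring]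
  exact Complex.norm_exp_ofReal_mul_I _
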